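/- Let w(n) be a stable sequence with limiting partition (S_1,…,S_r), where r ≥ 2. Then f_{2d−2|S_r|}(λ, w(n)) → 0 as n → ∞; equivalently, the (d−|S_r|, d−|S_r|+1) entry of the matrix f(λ, w(n)) tends to 0. -/

import Mathlib

noncomputable section
open Polynomial Filter Topology ENNReal

/-- The inner product `⟨p,q⟩_v = ∑ₖ p(μₖ)q(μₖ)vₖ`. -/
def ip {m : ℕ} (μ v : Fin m → ℝ) (p q : ℝ[X]) : ℝ :=
  ∑ k, p.eval (μ k) * q.eval (μ k) * v k

/-- Pair `(pₙ, pₙ₋₁)` of monic orthogonal polynomials (with `p₋₁ = 0`). -/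
def opAux {m : ℕ} (μ v : Fin m → ℝ) : ℕ → ℝ[X] × ℝ[X]
  | 0 => (1, 0)
  | n + 1 =>
    let P := opAux μ v n
    ((X - C (ip μ v P.1 (X * P.1) / ip μ v P.1 P.1)) * P.1
        - C (ip μ v P.1 P.1 / ip μ v P.2 P.2) * P.2, P.1)

/-- The `n`-th monic orthogonal polynomial of the recursion. -/
def op {m : ℕ} (μ v : Fin m → ℝ) (n : ℕ) : ℝ[X] := (opAux μ v n).1

/-- The entry `a_N` of the Jacobi matrix construction: for odd `N = 2n+1` the diagonal
entry `a_{2n+1} = ⟨pₙ, Xpₙ⟩/⟨pₙ,pₙ⟩`, for even `N = 2n` the off-diagonal entry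
`a_{2n} = √(⟨pₙ,pₙ⟩/⟨pₙ₋₁,pₙ₋₁⟩)`. -/
def fEnt {m : ℕ} (μ v : Fin m → ℝ) (N : ℕ) : ℝ :=
  if N % 2 = 1 then
    ip μ v (op μ v (N / 2)) (X * op μ v (N / 2)) / ip μ v (op μ v (N / 2)) (op μ v (N / 2))
  else
    Real.sqrt (ip μ v (op μ v (N / 2)) (op μ v (N / 2)) /
      ip μ v (op μ v (N / 2 - 1)) (op μ v (N / 2 - 1)))

/-- The symmetric tridiagonal matrix `f(μ, v)` with diagonal `a₁,a₃,…` and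
sub/super-diagonal `a₂,a₄,…`. -/
def Jmat {m : ℕ} (μ v : Fin m → ℝ) : Matrix (Fin m) (Fin m) ℝ :=
  Matrix.of fun i j =>
    if i = j then fEnt μ v (2 * (i : ℕ) + 1)
    else if (i : ℕ) + 1 = (j : ℕ) ∨ (j : ℕ) + 1 = (i : ℕ) then fEnt μ v ((i : ℕ) + (j : ℕ) + 1)
    else 0

/-- Restriction of `g : Fin d → ℝ` to a subset `Q`, reindexed in increasing order. -/
def restr {d : ℕ} (Q : Finset (Fin d)) (g : Fin d → ℝ) : Fin Q.card → ℝ :=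
  fun k => g ((Q.orderIsoOfFin rfl) k).1

/-- Leading `i × i` principal submatrix. -/
def leadSub {d : ℕ} (J : Matrix (Fin d) (Fin d) ℝ) (i : ℕ) (h : i ≤ d) :
    Matrix (Fin i) (Fin i) ℝ :=
  Matrix.of fun a b => J ⟨a.1, lt_of_lt_of_le a.2 h⟩ ⟨b.1, lt_of_lt_of_le b.2 h⟩

/-- A sequence of positive weight vectors is stable if all pairwise ratios converge
in `[0,∞]`. -/
def Stable {d : ℕ} (w : ℕ → Fin d → ℝ) : Prop :=
  (∀ n i, 0 < w n i) ∧
    ∀ i j : Fin d, ∃ L : ℝ≥0∞,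
      Tendsto (fun n => ENNReal.ofReal (w n i / w n j)) atTop (𝓝 L)

/-- `S : Fin r → Finset (Fin d)` is an ordered partition of `{0,…,d-1}`. -/
def OrdPart {d r : ℕ} (S : Fin r → Finset (Fin d)) : Prop :=
  (∀ j, (S j).Nonempty) ∧ (∀ j k, j ≠ k → Disjoint (S j) (S k)) ∧
    Finset.univ.biUnion S = (Finset.univ : Finset (Fin d))

/-- `S` is the limiting partition of the stable sequence `w`. -/
def LimPart {d r : ℕ} (w : ℕ → Fin d → ℝ) (S : Fin r → Finset (Fin d)) : Prop :=
  OrdPart S ∧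
  (∀ i j : Fin d, (∃ a, i ∈ S a ∧ j ∈ S a) ↔
      ∃ L : ℝ, 0 < L ∧ Tendsto (fun n => w n i / w n j) atTop (𝓝 L)) ∧
  (∀ a b : Fin r, a < b → ∀ i ∈ S a, ∀ j ∈ S b,
      Tendsto (fun n => w n i / w n j) atTop atTop)

/-- The constant `C_i^T = ∏_{t ∈ T} (λ_t − λ_i)²`. -/
def Cc {d : ℕ} (lam : Fin d → ℝ) (i : Fin d) (T : Finset (Fin d)) : ℝ :=
  ∏ t ∈ T, (lam t - lam i) ^ 2

/-- Offset `∑_{k<j} |S_k|` of the `j`-th block. -/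
def offS {d r : ℕ} (S : Fin r → Finset (Fin d)) (j : Fin r) : ℕ :=
  ∑ k ∈ Finset.univ.filter (· < j), (S k).card

/-- The block-diagonal matrix whose `j`-th block (in rows/columns
`offS S j, …, offS S j + |S_j| - 1`) is `Jmat (restr (S j) lam) (restr (S j) (v j))`. -/
def blockDiag {d r : ℕ} (lam : Fin d → ℝ) (S : Fin r → Finset (Fin d))
    (v : Fin r → Fin d → ℝ) : Matrix (Fin d) (Fin d) ℝ :=
  Matrix.of fun p q =>
    ∑ j : Fin r,
      if h : offS S j ≤ (p : ℕ) ∧ (p : ℕ) < offS S j + (S j).card ∧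
          offS S j ≤ (q : ℕ) ∧ (q : ℕ) < offS S j + (S j).card then
        Jmat (restr (S j) lam) (restr (S j) (v j))
          ⟨(p : ℕ) - offS S j, by omega⟩ ⟨(q : ℕ) - offS S j, by omega⟩
      else 0

/-- Nonempty subsets of `Fin d`. -/
abbrev NES (d : ℕ) := {S : Finset (Fin d) // S.Nonempty}

/-- The ambient Euclidean space of families `(w^S)` indexed by nonempty subsets. -/
abbrev Ew (d : ℕ) := NES d → Fin d → ℝ

/-- The blow-up `B` (normalized representatives): support, nonnegativity,
normalization, and the quadratic equations. -/
def Bset {d : ℕ} (lam : Fin d → ℝ) : Set (Ew d) :=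
  {w | (∀ S : NES d, ∀ n, n ∉ S.1 → w S n = 0) ∧
    (∀ S n, 0 ≤ w S n) ∧
    (∀ S : NES d, ∑ n ∈ S.1, w S n = 1) ∧
    ∀ R S : NES d, R.1 ⊆ S.1 → ∀ i ∈ R.1, ∀ j ∈ R.1,
      Cc lam i (S.1 \ R.1) * w R j * w S i = Cc lam j (S.1 \ R.1) * w R i * w S j}

/-- `𝒥̄^Λ`: symmetric tridiagonal matrices with nonnegative off-diagonal entries and
characteristic polynomial `∏ (X − λ_k)`. -/
def Jset {d : ℕ} (lam : Fin d → ℝ) : Set (Matrix (Fin d) (Fin d) ℝ) :=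
  {J | (∀ i j, J i j = J j i) ∧
    (∀ i j : Fin d, (i : ℕ) + 2 ≤ (j : ℕ) ∨ (j : ℕ) + 2 ≤ (i : ℕ) → J i j = 0) ∧
    (∀ i j : Fin d, (i : ℕ) + 1 = (j : ℕ) → 0 ≤ J i j) ∧
    J.charpoly = ∏ k, (X - C (lam k))}

/-- `K_j = S_j ∪ S_{j+1} ∪ … ∪ S_r`. -/
def Kof {d r : ℕ} (S : Fin r → Finset (Fin d)) (j : Fin r) : Finset (Fin d) :=
  (Finset.univ.filter (j ≤ ·)).biUnion S

/-- The piece `Z(P)` of `B` corresponding to the ordered partition `P = (S_1,…,S_r)`: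
for every nonempty `T`, the support of `w^T` is `T ∩ S_{i(T,P)}`. -/
def Zset {d : ℕ} (lam : Fin d → ℝ) {r : ℕ} (S : Fin r → Finset (Fin d)) : Set (Ew d) :=
  {w | w ∈ Bset lam ∧ ∀ T : NES d, ∃ j : Fin r, T.1 ⊆ Kof S j ∧
    (∀ k, T.1 ⊆ Kof S k → k ≤ j) ∧ ∀ n : Fin d, w T n ≠ 0 ↔ n ∈ T.1 ∧ n ∈ S j}

/-- `R ⪯ S`: the ordered partition `R` refines `S`, i.e. `R` is the concatenation of
ordered partitions of `S_1`, then `S_2`, etc. -/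
def Refines {d q r : ℕ} (R : Fin q → Finset (Fin d)) (S : Fin r → Finset (Fin d)) : Prop :=
  ∃ b : Fin (r + 1) → ℕ, b 0 = 0 ∧ b (Fin.last r) = q ∧
    (∀ i j : Fin (r + 1), i ≤ j → b i ≤ b j) ∧
    ∀ i : Fin r, S i = (Finset.univ.filter
      (fun k : Fin q => b i.castSucc ≤ (k : ℕ) ∧ (k : ℕ) < b i.succ)).biUnion R

/-- The `j`-th consecutive interval `I_j(T)` of lengths `|T_1|,…,|T_r|`. -/
def Iint {d r : ℕ} (T : Fin r → Finset (Fin d)) (j : Fin r) : Finset (Fin d) :=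
  Finset.univ.filter (fun m : Fin d => offS T j ≤ (m : ℕ) ∧ (m : ℕ) < offS T j + (T j).card)

/-- `H(T) = {σ : σ(T_j) = I_j(T) for all j}`. -/
def Hset {d r : ℕ} (T : Fin r → Finset (Fin d)) : Set (Equiv.Perm (Fin d)) :=
  {σ | ∀ j, (T j).image σ = Iint T j}

/-- Interval Young subgroups: setwise stabilizers of a division of `{0,…,d-1}` into
consecutive intervals. -/
def IsIntervalYoung {d : ℕ} (G : Set (Equiv.Perm (Fin d))) : Prop :=
  ∃ (q : ℕ) (c : Fin q → Finset (Fin d)), OrdPart c ∧ (∀ j : Fin q, c j = Iint c j) ∧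
    G = {τ : Equiv.Perm (Fin d) | ∀ j, (c j).image ⇑τ = c j}

/-- Number of surjections from an `a`-element set onto a `b`-element set. -/
def Surj (a b : ℕ) : ℕ := Fintype.card {f : Fin a → Fin b // Function.Surjective f}

/-- The Euler characteristic `χ_d = ∑_{q=1}^d (−2)^{d−q}·Surj(d,q)`. -/
def chi (a : ℕ) : ℝ := ∑ q ∈ Finset.Icc 1 a, (-2 : ℝ) ^ (a - q) * (Surj a q : ℝ)

lemma ip_comm {m : ℕ} (μ v : Fin m → ℝ) (p q : ℝ[X]) : ip μ v p q = ip μ v q p := by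
  simp only [ip, mul_comm (p.eval _)]

lemma ip_add_left {m : ℕ} (μ v : Fin m → ℝ) (p q s : ℝ[X]) :
    ip μ v (p + q) s = ip μ v p s + ip μ v q s := by
  simp only [ip, eval_add, add_mul, Finset.sum_add_distrib]

lemma ip_sub_left {m : ℕ} (μ v : Fin m → ℝ) (p q s : ℝ[X]) :
    ip μ v (p - q) s = ip μ v p s - ip μ v q s := by
  simp only [ip, eval_sub, sub_mul, Finset.sum_sub_distrib]

lemma ip_C_mul_left {m : ℕ} (μ v : Fin m → ℝ) (c : ℝ) (p s : ℝ[X]) :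
    ip μ v (C c * p) s = c * ip μ v p s := by
  simp only [ip, eval_mul, eval_C, mul_assoc, Finset.mul_sum]

lemma ip_X_mul_left {m : ℕ} (μ v : Fin m → ℝ) (p s : ℝ[X]) :
    ip μ v (X * p) s = ip μ v p (X * s) := by
  simp only [ip, eval_mul, eval_X]
  exact Finset.sum_congr rfl fun k _ => by ring

lemma ip_add_right {m : ℕ} (μ v : Fin m → ℝ) (p q s : ℝ[X]) :
    ip μ v s (p + q) = ip μ v s p + ip μ v s q := by
  simp only [ip_comm μ v s, ip_add_left]

lemma ip_C_mul_right {m : ℕ} (μ v : Fin m → ℝ) (c : ℝ) (p s : ℝ[X]) :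
    ip μ v s (C c * p) = c * ip μ v s p := by
  simp only [ip_comm μ v s, ip_C_mul_left]

lemma ip_self_nonneg {m : ℕ} {μ v : Fin m → ℝ} (hv : ∀ k, 0 < v k) (p : ℝ[X]) :
    0 ≤ ip μ v p p :=
  Finset.sum_nonneg fun k _ => mul_nonneg (mul_self_nonneg _) (hv k).le

lemma ip_self_pos {m : ℕ} {μ v : Fin m → ℝ} (hμ : Function.Injective μ) (hv : ∀ k, 0 < v k)
    {p : ℝ[X]} (hp : p ≠ 0) (hdeg : p.natDegree < m) : 0 < ip μ v p p := by
  refine (ip_self_nonneg hv p).lt_of_ne' fun h => hp ?_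
  rw [ip, Finset.sum_eq_zero_iff_of_nonneg
    fun k _ => mul_nonneg (mul_self_nonneg _) (hv k).le] at h
  refine eq_zero_of_natDegree_lt_card_of_eval_eq_zero p hμ (fun k => ?_) (by simpa using hdeg)
  simpa [(hv k).ne'] using h k (Finset.mem_univ k)

lemma op_zero {m : ℕ} (μ v : Fin m → ℝ) : op μ v 0 = 1 := rfl

lemma op_one {m : ℕ} (μ v : Fin m → ℝ) :
    op μ v 1 = X - C (ip μ v 1 (X * 1) / ip μ v 1 1) := by
  simp [op, opAux]

lemma op_add_two {m : ℕ} (μ v : Fin m → ℝ) (n : ℕ) :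
    op μ v (n + 2) =
      (X - C (ip μ v (op μ v (n + 1)) (X * op μ v (n + 1)) /
          ip μ v (op μ v (n + 1)) (op μ v (n + 1)))) * op μ v (n + 1)
        - C (ip μ v (op μ v (n + 1)) (op μ v (n + 1)) / ip μ v (op μ v n) (op μ v n))
          * op μ v n := rfl

lemma op_monic_natDegree {m : ℕ} (μ v : Fin m → ℝ) (n : ℕ) :
    (op μ v n).Monic ∧ (op μ v n).natDegree = n := by
  induction n using Nat.twoStepInduction with
  | zero => simp [op_zero]
  | one => rw [op_one]; exact ⟨monic_X_sub_C _, natDegree_X_sub_C _⟩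
  | more n ih₀ ih₁ =>
    rw [op_add_two]
    set a := ip μ v (op μ v (n + 1)) (X * op μ v (n + 1)) /
      ip μ v (op μ v (n + 1)) (op μ v (n + 1))
    set b := ip μ v (op μ v (n + 1)) (op μ v (n + 1)) / ip μ v (op μ v n) (op μ v n)
    have hmon : ((X - C a) * op μ v (n + 1)).Monic := (monic_X_sub_C a).mul ih₁.1
    have hdeg : ((X - C a) * op μ v (n + 1)).natDegree = n + 2 := by
      rw [(monic_X_sub_C a).natDegree_mul ih₁.1, natDegree_X_sub_C, ih₁.2]
      ring
    have hlt : (C b * op μ v n).natDegree < ((X - C a) * op μ v (n + 1)).natDegree := by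
      have := natDegree_C_mul_le b (op μ v n)
      omega
    exact ⟨hmon.sub_of_left (degree_lt_degree hlt),
      (natDegree_sub_eq_left_of_natDegree_lt hlt).trans hdeg⟩

/-- A polynomial of degree at most `n` splits off its component along a monic one of
degree `n`. -/
lemma exists_eq_add_C_mul_of_monic {p q : ℝ[X]} {n : ℕ} (hp : p.Monic) (hpn : p.natDegree = n)
    (hq : q.degree < (n + 1 : ℕ)) :
    ∃ s : ℝ[X], s.degree < n ∧ q = s + C (q.coeff n) * p := by
  refine ⟨q - C (q.coeff n) * p, ?_, by ring⟩
  rw [degree_lt_iff_coeff_zero] at hq ⊢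
  intro k hk
  rw [coeff_sub, coeff_C_mul]
  rcases hk.eq_or_lt with rfl | hk
  · have : p.coeff n = 1 := hpn ▸ hp.coeff_natDegree
    simp [this]
  · simp [hq k hk, coeff_eq_zero_of_natDegree_lt (hpn.trans_lt hk)]

lemma ip_op_eq_zero_of_degree_lt {m : ℕ} {μ v : Fin m → ℝ} (hμ : Function.Injective μ)
    (hv : ∀ k, 0 < v k) {n : ℕ} (hn : n ≤ m) {q : ℝ[X]} (hq : q.degree < n) :
    ip μ v (op μ v n) q = 0 := by
  have hpos : ∀ k < m, ip μ v (op μ v k) (op μ v k) ≠ 0 := fun k hk =>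
    (ip_self_pos hμ hv (op_monic_natDegree μ v k).1.ne_zero
      ((op_monic_natDegree μ v k).2.trans_lt hk)).ne'
  have hz : ∀ {s : ℝ[X]}, s.degree < (0 : ℕ) → s = 0 := fun hs => by
    rw [degree_lt_iff_coeff_zero] at hs
    ext k
    exact hs k k.zero_le
  induction n using Nat.twoStepInduction generalizing q with
  | zero => simp [hz hq, ip]
  | one =>
    obtain ⟨s, hs, hqs⟩ :=
      exists_eq_add_C_mul_of_monic (op_monic_natDegree μ v 0).1 (op_monic_natDegree μ v 0).2 hq
    rw [hqs, hz hs, zero_add, ip_C_mul_right, op_one, op_zero, ip_sub_left]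
    have h0 := hpos 0 (by omega)
    rw [op_zero] at h0
    have h1 := ip_C_mul_left μ v (ip μ v 1 (X * 1) / ip μ v 1 1) 1 1
    rw [mul_one, div_mul_cancel₀ _ h0] at h1
    rw [h1, ip_comm μ v 1, mul_one, sub_self, mul_zero]
  | more n ih₀ ih₁ =>
    have ih₀ := fun {q : ℝ[X]} => ih₀ (q := q) (by omega)
    have ih₁ := fun {q : ℝ[X]} => ih₁ (q := q) (by omega)
    have h₀ := op_monic_natDegree μ v n
    have h₁ := op_monic_natDegree μ v (n + 1)
    have hp₀ := hpos n (by omega)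
    have hp₁ := hpos (n + 1) (by omega)
    have horth : ip μ v (op μ v (n + 1)) (op μ v n) = 0 := by
      refine ih₁ (lt_of_le_of_lt degree_le_natDegree ?_)
      rw [h₀.2]
      exact_mod_cast n.lt_succ_self
    obtain ⟨s, hs, hqs⟩ := exists_eq_add_C_mul_of_monic h₁.1 h₁.2 hq
    obtain ⟨t, ht, hst⟩ := exists_eq_add_C_mul_of_monic h₀.1 h₀.2 hs
    have hXs : (X * s).degree < ((n + 1 + 1 : ℕ) : WithBot ℕ) := by
      rw [degree_lt_iff_coeff_zero] at hs ⊢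
      intro k hk
      obtain ⟨k, rfl⟩ : ∃ j, k = j + 1 := ⟨k - 1, by omega⟩
      rw [coeff_X_mul]
      exact hs k (by omega)
    obtain ⟨u, hu, hXu⟩ := exists_eq_add_C_mul_of_monic h₁.1 h₁.2 hXs
    rw [coeff_X_mul] at hXu
    have hlow : ip μ v (op μ v n) s = s.coeff n * ip μ v (op μ v n) (op μ v n) := by
      conv_lhs => rw [hst]
      rw [ip_add_right, ih₀ ht, ip_C_mul_right, zero_add]
    have hmid : ip μ v (op μ v (n + 1)) (X * s) =
        s.coeff n * ip μ v (op μ v (n + 1)) (op μ v (n + 1)) := by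
      rw [hXu, ip_add_right, ih₁ hu, ip_C_mul_right, zero_add]
    have hs0 : ip μ v (op μ v (n + 2)) s = 0 := by
      rw [op_add_two, ip_sub_left, sub_mul, ip_sub_left, ip_X_mul_left, ip_C_mul_left,
        ip_C_mul_left, hmid, hlow, ih₁ hs]
      field_simp
      ring
    have hp0 : ip μ v (op μ v (n + 2)) (op μ v (n + 1)) = 0 := by
      rw [op_add_two, ip_sub_left, sub_mul, ip_sub_left, ip_X_mul_left, ip_C_mul_left,
        ip_C_mul_left, ip_comm μ v (op μ v n) (op μ v (n + 1)), horth, div_mul_cancel₀ _ hp₁]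
      ring
    rw [hqs, ip_add_right, hs0, ip_C_mul_right, hp0, mul_zero, add_zero]

/-- Orthogonal polynomials minimize the norm among monic polynomials of the same degree. -/
lemma ip_op_self_le {m : ℕ} {μ v : Fin m → ℝ} (hμ : Function.Injective μ) (hv : ∀ k, 0 < v k)
    {n : ℕ} (hn : n ≤ m) {q : ℝ[X]} (hq : q.Monic) (hqn : q.natDegree = n) :
    ip μ v (op μ v n) (op μ v n) ≤ ip μ v q q := by
  have h := op_monic_natDegree μ v n
  obtain ⟨s, hs, hqs⟩ := exists_eq_add_C_mul_of_monic h.1 h.2 (q := q)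
    (lt_of_le_of_lt degree_le_natDegree (by rw [hqn]; exact_mod_cast n.lt_succ_self))
  have h1 : q.coeff n = 1 := hqn ▸ hq.coeff_natDegree
  rw [h1, C_1, one_mul] at hqs
  have horth := ip_op_eq_zero_of_degree_lt hμ hv hn hs
  rw [hqs, ip_add_left, ip_add_right, ip_add_right, ip_comm μ v s (op μ v n), horth]
  linarith [ip_self_nonneg (μ := μ) hv s]

/-- Lower bound for the norm of a monic polynomial of degree `|K| - 1` in terms of the weights
on `K`. -/
lemma one_le_ip_self_mul_sum {m : ℕ} {μ v : Fin m → ℝ} (hμ : Function.Injective μ)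
    (hv : ∀ k, 0 < v k) {K : Finset (Fin m)} (hK : K.Nonempty) {p : ℝ[X]} (hp : p.Monic)
    (hpn : p.natDegree = K.card - 1) :
    1 ≤ ip μ v p p * ∑ k ∈ K, (∏ i ∈ K.erase k, (μ k - μ i))⁻¹ ^ 2 / v k := by
  have hcard := hK.card_pos
  have hlead := Lagrange.coeff_eq_sum (s := K) (v := μ) hμ.injOn (P := p)
    (lt_of_le_of_lt degree_le_natDegree (by rw [hpn]; exact_mod_cast Nat.sub_one_lt_of_lt hcard))
  rw [← hpn, hp.coeff_natDegree] at hlead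
  calc (1 : ℝ) = (∑ k ∈ K, p.eval (μ k) / ∏ i ∈ K.erase k, (μ k - μ i)) ^ 2 := by
        rw [← hlead, one_pow]
    _ ≤ (∑ k ∈ K, p.eval (μ k) * p.eval (μ k) * v k) *
          ∑ k ∈ K, (∏ i ∈ K.erase k, (μ k - μ i))⁻¹ ^ 2 / v k := by
        refine Finset.sum_sq_le_sum_mul_sum_of_sq_le_mul K
          (fun k _ => mul_nonneg (mul_self_nonneg _) (hv k).le)
          (fun k _ => div_nonneg (sq_nonneg _) (hv k).le) fun k _ => le_of_eq ?_
        have := (hv k).ne'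
        field_simp
    _ ≤ _ := by
        refine mul_le_mul_of_nonneg_right ?_
          (Finset.sum_nonneg fun k _ => div_nonneg (sq_nonneg _) (hv k).le)
        exact Finset.sum_le_sum_of_subset_of_nonneg K.subset_univ
          fun k _ _ => mul_nonneg (mul_self_nonneg _) (hv k).le

lemma ip_nodal_self {m : ℕ} (μ v : Fin m → ℝ) (K : Finset (Fin m)) :
    ip μ v (Lagrange.nodal K μ) (Lagrange.nodal K μ) =
      ∑ j ∈ Kᶜ, (Lagrange.nodal K μ).eval (μ j) ^ 2 * v j := by
  rw [ip, ← Finset.sum_add_sum_compl K, Finset.sum_eq_zero, zero_add]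
  · exact Finset.sum_congr rfl fun j _ => by rw [sq]
  · intro k hk
    simp [Lagrange.eval_nodal_at_node hk]

/-- The squared off-diagonal entry at position `|K|` is controlled by the weight ratios between
the complement of `K` and `K`. -/
lemma ip_op_div_le_sum {m : ℕ} {μ v : Fin m → ℝ} (hμ : Function.Injective μ)
    (hv : ∀ k, 0 < v k) {K : Finset (Fin m)} (hK : K.Nonempty) :
    ip μ v (op μ v K.card) (op μ v K.card) /
        ip μ v (op μ v (K.card - 1)) (op μ v (K.card - 1)) ≤
      ∑ j ∈ Kᶜ, ∑ k ∈ K, ((Lagrange.nodal K μ).eval (μ j) ^ 2 *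
        (∏ i ∈ K.erase k, (μ k - μ i))⁻¹ ^ 2) * (v j / v k) := by
  have hKm : K.card ≤ m := by simpa using K.card_le_univ
  have hcard := hK.card_pos
  have h := op_monic_natDegree μ v (K.card - 1)
  have hpos : 0 < ip μ v (op μ v (K.card - 1)) (op μ v (K.card - 1)) :=
    ip_self_pos hμ hv h.1.ne_zero (by omega)
  have hnum := ip_op_self_le hμ hv hKm (Lagrange.nodal_monic (s := K) (v := μ))
    Lagrange.natDegree_nodal
  have hden := one_le_ip_self_mul_sum hμ hv hK h.1 h.2
  have hN : 0 ≤ ip μ v (Lagrange.nodal K μ) (Lagrange.nodal K μ) := ip_self_nonneg hv _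
  rw [div_le_iff₀ hpos]
  calc _ ≤ ip μ v (Lagrange.nodal K μ) (Lagrange.nodal K μ) * 1 := by rwa [mul_one]
    _ ≤ ip μ v (Lagrange.nodal K μ) (Lagrange.nodal K μ) * _ :=
        mul_le_mul_of_nonneg_left hden hN
    _ = (ip μ v (Lagrange.nodal K μ) (Lagrange.nodal K μ) *
          ∑ k ∈ K, (∏ i ∈ K.erase k, (μ k - μ i))⁻¹ ^ 2 / v k) *
          ip μ v (op μ v (K.card - 1)) (op μ v (K.card - 1)) := by ring
    _ = _ := by
        rw [ip_nodal_self, Finset.sum_mul_sum]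
        congr 1
        exact Finset.sum_congr rfl fun j _ => Finset.sum_congr rfl fun k _ => by ring

lemma tendsto_fEnt_zero {d : ℕ} {lam : Fin d → ℝ} (hlam : Function.Injective lam)
    {w : ℕ → Fin d → ℝ} (hw : ∀ n i, 0 < w n i) {K : Finset (Fin d)} (hK : K.Nonempty)
    (hlim : ∀ k ∈ K, ∀ j ∉ K, Tendsto (fun n => w n k / w n j) atTop atTop) :
    Tendsto (fun n => fEnt lam (w n) (2 * K.card)) atTop (𝓝 0) := by
  have hbound : Tendsto (fun n => ∑ j ∈ Kᶜ, ∑ k ∈ K, ((Lagrange.nodal K lam).eval (lam j) ^ 2 *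
      (∏ i ∈ K.erase k, (lam k - lam i))⁻¹ ^ 2) * (w n j / w n k)) atTop (𝓝 0) := by
    have : (0 : ℝ) = ∑ j ∈ Kᶜ, ∑ k ∈ K, ((Lagrange.nodal K lam).eval (lam j) ^ 2 *
      (∏ i ∈ K.erase k, (lam k - lam i))⁻¹ ^ 2) * 0 := by simp
    rw [this]
    refine tendsto_finsetSum _ fun j hj => tendsto_finsetSum _ fun k hk => ?_
    refine Tendsto.const_mul _ ?_
    simpa [Function.comp_def] using
      tendsto_inv_atTop_zero.comp (hlim k hk j (Finset.mem_compl.1 hj))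
  have hsq := squeeze_zero
    (fun n => div_nonneg (ip_self_nonneg (μ := lam) (hw n) (op lam (w n) K.card))
      (ip_self_nonneg (μ := lam) (hw n) (op lam (w n) (K.card - 1))))
    (fun n => ip_op_div_le_sum hlam (hw n) hK) hbound
  simpa [fEnt] using hsq.sqrt

/-- Lemma 17: the entry `a_{2d−2|S_r|}` tends to `0`. -/
theorem stmt5 {d r : ℕ} (hd : 1 ≤ d) (lam : Fin d → ℝ) (hlam : Function.Injective lam)
    (w : ℕ → Fin d → ℝ) (hstab : Stable w)
    (S : Fin r → Finset (Fin d)) (hS : LimPart w S) (hr : 2 ≤ r) :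
    Tendsto (fun n => fEnt lam (w n) (2 * d - 2 * (S ⟨r - 1, by omega⟩).card))
      atTop (𝓝 0) ∧
    ∀ p q : Fin d, (p : ℕ) + 1 = d - (S ⟨r - 1, by omega⟩).card →
      (q : ℕ) = d - (S ⟨r - 1, by omega⟩).card →
      Tendsto (fun n => Jmat lam (w n) p q) atTop (𝓝 0) := by
  have hcard : (S ⟨r - 1, by omega⟩)ᶜ.card = d - (S ⟨r - 1, by omega⟩).card := by
    rw [Finset.card_compl, Fintype.card_fin]
  have hne : ((S ⟨r - 1, by omega⟩)ᶜ).Nonempty := by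
    obtain ⟨i, hi⟩ := hS.1.1 ⟨0, by omega⟩
    refine ⟨i, Finset.mem_compl.2 ?_⟩
    exact Finset.disjoint_left.1
      (hS.1.2.1 ⟨0, by omega⟩ ⟨r - 1, by omega⟩ (by simp only [ne_eq, Fin.mk.injEq]; omega)) hi
  have hmain := tendsto_fEnt_zero hlam hstab.1 hne fun k hk j hj => by
    obtain ⟨a, -, ha⟩ := Finset.mem_biUnion.1 (hS.1.2.2 ▸ Finset.mem_univ k)
    rw [Finset.mem_compl, not_not] at hj
    refine hS.2.2 a _ (lt_of_le_of_ne (Fin.mk_le_mk.2 (by omega)) ?_) k ha j hj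
    rintro rfl
    exact Finset.mem_compl.1 hk ha
  rw [hcard] at hmain
  refine ⟨by simpa only [Nat.mul_sub] using hmain, fun p q hp hq => ?_⟩
  have hpq : p ≠ q := fun h => by rw [h] at hp; omega
  have hJ : ∀ n, Jmat lam (w n) p q =
      fEnt lam (w n) (2 * (d - (S ⟨r - 1, by omega⟩).card)) := fun n => by
    rw [Jmat, Matrix.of_apply, if_neg hpq, if_pos (Or.inl (hp.trans hq.symm))]
    congr 1
    omega
  simpa only [hJ] using hmain
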